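/- Let p be a prime and let R be a commutative ring with p·R = 0 such that R/nilradical(R) is a perfect 𝔽_p-algebra (its Frobenius endomorphism is bijective). Then for every a ∈ R there exists a sequence v : ℕ → W(R) of p-typical Witt vectors such that F(v_{i+1}) − v_i ∈ Ŵ(R) for every i ≥ 0, and the 0-th Witt coefficient of v₀ is congruent to a modulo the nilradical of R. -/

import Mathlib

/-!
STATEMENT 1: Let p be a prime and let R be a commutative ring with p·R = 0 such that
R/nilradical(R) is a perfect 𝔽_p-algebra.  Then for every a ∈ R there exists a
sequence v : ℕ → W(R) of p-typical Witt vectors such that F(v (i+1)) − v i ∈ Ŵ(R) for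
every i ≥ 0, and the 0-th Witt coefficient of v 0 is congruent to a modulo the
nilradical of R.
-/

/-- `Ŵ(S)`: the Witt vectors all of whose coefficients are nilpotent and all but
finitely many of whose coefficients are zero. -/
def IsHatW (p : ℕ) [Fact p.Prime] {S : Type*} [CommRing S] (x : WittVector p S) : Prop :=
  (∀ n, IsNilpotent (x.coeff n)) ∧ ∃ N, ∀ n ≥ N, x.coeff n = 0

open WittVector in
lemma aux_trunc_zero (p : ℕ) [Fact p.Prime] {R : Type*} [CommRing R] (m : ℕ)
    (x y : WittVector p R) :
    WittVector.truncate m x = WittVector.truncate m y ↔ ∀ n < m, x.coeff n = y.coeff n := by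
  constructor
  · intro h n hn
    have := congrArg (TruncatedWittVector.coeff ⟨n, hn⟩) h
    simpa [WittVector.coeff_truncate] using this
  · intro h
    ext i
    simpa [WittVector.coeff_truncate] using h i i.2

/-- A `V`-adically convergent infinite sum. -/
lemma aux_sum (p : ℕ) [Fact p.Prime] {R : Type*} [CommRing R]
    (s : ℕ → WittVector p R) (hs : ∀ j, ∀ n < j, (s j).coeff n = 0) :
    ∃ S : WittVector p R, ∀ m k, m ≤ k →
      WittVector.truncate m S = WittVector.truncate m (∑ j ∈ Finset.range k, s j) := by
  have key : ∀ m k, m ≤ k → WittVector.truncate m (∑ j ∈ Finset.range k, s j)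
      = WittVector.truncate m (∑ j ∈ Finset.range m, s j) := by
    intro m k hk
    induction k, hk using Nat.le_induction with
    | base => rfl
    | succ k hk ih =>
      rw [Finset.sum_range_succ, map_add, ih]
      have : WittVector.truncate m (s k) = WittVector.truncate m 0 := by
        rw [aux_trunc_zero]
        intro n hn
        rw [hs k n (by omega), WittVector.zero_coeff]
      rw [this, map_zero, add_zero]
  refine ⟨WittVector.mk p fun n => (∑ j ∈ Finset.range (n + 1), s j).coeff n, ?_⟩
  intro m k hk
  rw [aux_trunc_zero]
  intro n hn
  have := (aux_trunc_zero p (n + 1) _ _).1 (key (n + 1) k (by omega)) n (by omega)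
  rw [this, WittVector.coeff_mk]

theorem perfection_approximation_in_witt_vectors (p : ℕ) [hp : Fact p.Prime]
    (R : Type*) [CommRing R] [CharP R p]
    (hperf : Function.Bijective (fun x : R ⧸ nilradical R => x ^ p))
    (a : R) :
    ∃ v : ℕ → WittVector p R,
      (∀ i : ℕ, IsHatW p (WittVector.frobenius (v (i + 1)) - v i)) ∧
      (v 0).coeff 0 - a ∈ nilradical R := by
  have hroot : ∀ x : R, ∃ y : R, y ^ p - x ∈ nilradical R := by
    intro x
    obtain ⟨z, hz⟩ := hperf.2 (Ideal.Quotient.mk _ x)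
    obtain ⟨y, rfl⟩ := Ideal.Quotient.mk_surjective z
    refine ⟨y, ?_⟩
    rw [← Ideal.Quotient.eq, map_pow]
    exact hz
  choose f hf using hroot
  let u : ℕ → R := fun i => f^[i] a
  have hu : ∀ i, u (i + 1) ^ p - u i ∈ nilradical R := by
    intro i
    simp only [u, Function.iterate_succ_apply']
    exact hf _
  let t : ℕ → WittVector p R := fun i => WittVector.teichmuller p (u i)
  let d : ℕ → WittVector p R := fun i => WittVector.frobenius (t (i + 1)) - t i
  have hd : ∀ i n, IsNilpotent ((d i).coeff n) := by
    intro i n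
    rw [← mem_nilradical, ← Ideal.Quotient.eq_zero_iff_mem, ← WittVector.map_coeff]
    have : WittVector.map (Ideal.Quotient.mk (nilradical R)) (d i) = 0 := by
      simp only [d, map_sub, sub_eq_zero]
      ext k
      rw [WittVector.map_coeff, WittVector.map_coeff, WittVector.coeff_frobenius_charP]
      rcases Nat.eq_zero_or_pos k with rfl | hk
      · simp only [t, WittVector.teichmuller_coeff_zero]
        exact Ideal.Quotient.eq.2 (hu i)
      · simp only [t, WittVector.teichmuller_coeff_pos _ _ _ hk]
        rw [zero_pow hp.out.ne_zero]
    rw [this, WittVector.zero_coeff]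
  let r : ℕ → WittVector p R := fun i => WittVector.select (fun n => i + 1 ≤ n) (d i)
  have hr : ∀ i, ∀ n < i + 1, (r i).coeff n = 0 := by
    intro i n hn
    simp only [r, WittVector.select, WittVector.coeff_mk]
    rw [if_neg (by omega)]
  have hdr : ∀ i, IsHatW p (d i - r i) := by
    intro i
    have : d i - r i = WittVector.select (fun n => ¬ (i + 1 ≤ n)) (d i) := by
      rw [sub_eq_iff_eq_add', WittVector.select_add_select_not]
    rw [this]
    refine ⟨fun n => ?_, i + 1, fun n hn => ?_⟩
    · simp only [WittVector.select, WittVector.coeff_mk]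
      split_ifs
      · exact IsNilpotent.zero
      · exact hd i n
    · simp only [WittVector.select, WittVector.coeff_mk]
      rw [if_neg (by omega)]
  let F : WittVector p R →+* WittVector p R := WittVector.frobenius
  have hF : ∀ (x : WittVector p R) m, (∀ n < m, x.coeff n = 0) → ∀ n < m, (F x).coeff n = 0 := by
    intro x m h n hn
    simp only [F]
    rw [WittVector.coeff_frobenius_charP, h n hn, zero_pow hp.out.ne_zero]
  have hFj : ∀ j (x : WittVector p R) m, (∀ n < m, x.coeff n = 0) →
      ∀ n < m, (F^[j] x).coeff n = 0 := by
    intro j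
    induction j with
    | zero => intro x m h; exact h
    | succ j ih =>
      intro x m h
      rw [Function.iterate_succ_apply']
      exact hF _ _ (ih x m h)
  have hS := fun i => aux_sum p (fun j => F^[j] (r (i + j))) (fun j n hn =>
    hFj j _ (i + j + 1) (hr (i + j)) n (by omega))
  choose S hS using hS
  have hrel : ∀ i, S i = r i + F (S (i + 1)) := by
    intro i
    ext n
    refine (aux_trunc_zero p (n + 1) _ _).1 ?_ n (by omega)
    rw [add_comm (r i), hS i (n + 1) (n + 2) (by omega), Finset.sum_range_succ', map_add, map_add]
    congr 1
    rw [aux_trunc_zero]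
    have h2 := (aux_trunc_zero p (n + 1) _ _).1 (hS (i + 1) (n + 1) (n + 1) le_rfl)
    intro m hm
    have h3 : (F (S (i + 1))).coeff m
        = (F (∑ j ∈ Finset.range (n + 1), F^[j] (r (i + 1 + j)))).coeff m := by
      simp only [F, WittVector.coeff_frobenius_charP]
      rw [h2 m hm]
    rw [h3, map_sum]
    congr 1
    refine Finset.sum_congr rfl fun j _ => ?_
    rw [Function.iterate_succ_apply']
    congr 3
    omega
  refine ⟨fun i => t i + S i, fun i => ?_, ?_⟩
  · have : WittVector.frobenius (t (i + 1) + S (i + 1)) - (t i + S i) = d i - r i := by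
      rw [hrel i, map_add]
      simp only [d, F]
      ring
    simp only [this]
    exact hdr i
  · have h0 : (S 0).coeff 0 = 0 := by
      have := (aux_trunc_zero p 1 _ _).1 (hS 0 1 1 le_rfl) 0 (by omega)
      rw [this]
      simpa using hr 0 0 (by omega)
    rw [WittVector.add_coeff_zero, h0]
    simp [t, u]
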